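/- Let (E,w,d) be an ultra triple, C ⊆ E finite, and m, r non-negative integers. Let (c_1,…,c_m) be any greedy r-removed m-permutation of C. Then for each k ∈ {0,1,…,m}, the set {c_1,…,c_k} has maximum r-removed perimeter among all k-subsets of C. -/

import Mathlib

open Finset

noncomputable def distR {E : Type*} [DecidableEq E] (d : E → E → ℝ) (r : ℕ)
    (C : Finset E) (v : E) : ℝ :=
  if C.card ≤ r then 0
  else sSup {s : ℝ | ∃ A ⊆ C, A.card = C.card - r ∧ s = ∑ x ∈ A, d v x}

noncomputable def perList {E : Type*} [DecidableEq E] (w : E → ℝ) (d : E → E → ℝ)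
    (r : ℕ) : List E → ℝ
  | [] => 0
  | a :: l => perList w d r l + w a + distR d r l.toFinset a

noncomputable def perR {E : Type*} [DecidableEq E] (w : E → ℝ) (d : E → E → ℝ)
    (r : ℕ) (A : Finset E) : ℝ := perList w d r A.toList

/-- `b` is a projection of `c` onto the finite set `A`. -/
def IsProj {E : Type*} [DecidableEq E] (d : E → E → ℝ) (A : Finset E) (c b : E) : Prop :=
  (c ∈ A ∧ b = c) ∨ (c ∉ A ∧ b ∈ A ∧ ∀ x ∈ A, d c b ≤ d c x)

/-- `v` is a sequential projection of the ordered set `c` (of length `k`) onto `A`. -/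
def IsSeqProj {E : Type*} [DecidableEq E] (d : E → E → ℝ) (A : Finset E)
    (k : ℕ) (c v : ℕ → E) : Prop :=
  ∀ i < k, IsProj d (A \ (Finset.range i).image v) (c i) (v i)

/-- `c` is a greedy `r`-removed `m`-permutation of `C`. -/
def IsGreedy {E : Type*} [DecidableEq E] (w : E → ℝ) (d : E → E → ℝ) (r : ℕ)
    (C : Finset E) (m : ℕ) (c : ℕ → E) : Prop :=
  (∀ i < m, c i ∈ C) ∧ (∀ i < m, ∀ j < m, c i = c j → i = j) ∧
  ∀ i < m, ∀ x ∈ C, x ∉ (Finset.range i).image c →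
    perR w d r (insert x ((Finset.range i).image c)) ≤
      perR w d r (insert (c i) ((Finset.range i).image c))

noncomputable def distF {E : Type*} [DecidableEq E] (d : E → E → ℝ)
    (f : ℕ → ℝ → ℝ) (C : Finset E) (x : E) : ℝ :=
  let l := (C.toList.map (fun c => d x c)).insertionSort (· ≤ ·)
  ∑ i ∈ Finset.range l.length, f (i + 1) (l.getD i 0)

lemma finite_removed_sums {E : Type*} (d : E → E → ℝ) (C : Finset E) (v : E)
    (n : ℕ) :
    {s : ℝ | ∃ A ⊆ C, A.card = n ∧ s = ∑ x ∈ A, d v x}.Finite := by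
  refine (C.powerset.finite_toSet.image fun A => ∑ x ∈ A, d v x).subset ?_
  rintro s ⟨A, hA, -, rfl⟩
  exact ⟨A, by simpa using hA, rfl⟩

section DistR

variable {E : Type*} [DecidableEq E] {d : E → E → ℝ} {r : ℕ}

lemma distR_eq_sSup (C : Finset E) (v : E) :
    distR d r C v = sSup {s : ℝ | ∃ A ⊆ C, A.card = C.card - r ∧ s = ∑ x ∈ A, d v x} := by
  unfold distR
  split_ifs with h
  · have : {s : ℝ | ∃ A ⊆ C, A.card = C.card - r ∧ s = ∑ x ∈ A, d v x} = {0} := by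
      ext s
      rw [Nat.sub_eq_zero_of_le h]
      constructor
      · rintro ⟨A, -, hA, rfl⟩
        simp [Finset.card_eq_zero.1 hA]
      · rintro rfl
        exact ⟨∅, by simp, by simp, by simp⟩
    rw [this, csSup_singleton]
  · rfl

lemma sum_le_distR {A C : Finset E} (hA : A ⊆ C) (hcard : A.card = C.card - r) (v : E) :
    ∑ x ∈ A, d v x ≤ distR d r C v := by
  rw [distR_eq_sSup]
  exact le_csSup (finite_removed_sums d C v _).bddAbove ⟨A, hA, hcard, rfl⟩

lemma exists_distR_eq_sum (d : E → E → ℝ) (r : ℕ) (C : Finset E) (v : E) :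
    ∃ A ⊆ C, A.card = C.card - r ∧ distR d r C v = ∑ x ∈ A, d v x := by
  rw [distR_eq_sSup]
  refine Set.Nonempty.csSup_mem ?_ (finite_removed_sums d C v _)
  obtain ⟨A, hA, hcard⟩ := Finset.exists_subset_card_eq (Nat.sub_le C.card r)
  exact ⟨_, A, hA, hcard, rfl⟩

lemma distR_eq_zero {C : Finset E} (h : C.card ≤ r) (v : E) : distR d r C v = 0 :=
  if_pos h

lemma distR_image_le_distR_image {n : ℕ} {u c : ℕ → E} {x : E}
    (hu : Set.InjOn u (Finset.range n)) (hc : Set.InjOn c (Finset.range n))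
    (h : ∀ j < n, d x (u j) ≤ d x (c j)) :
    distR d r ((Finset.range n).image u) x ≤ distR d r ((Finset.range n).image c) x := by
  obtain ⟨A, hA, hcard, hsum⟩ := exists_distR_eq_sum d r ((Finset.range n).image u) x
  obtain ⟨I, hI, rfl⟩ := Finset.subset_image_iff.1 hA
  have hI' : I ⊆ Finset.range n := by exact_mod_cast hI
  have huI : Set.InjOn u I := hu.mono hI
  have hcI : Set.InjOn c I := hc.mono hI
  rw [Finset.card_image_of_injOn huI, Finset.card_image_of_injOn hu] at hcard
  rw [hsum, Finset.sum_image huI]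
  calc ∑ j ∈ I, d x (u j) ≤ ∑ j ∈ I, d x (c j) :=
        Finset.sum_le_sum fun j hj => h j (Finset.mem_range.1 (hI' hj))
    _ = ∑ y ∈ I.image c, d x y := (Finset.sum_image hcI).symm
    _ ≤ _ := sum_le_distR (Finset.image_subset_image hI')
        (by rw [Finset.card_image_of_injOn hcI, Finset.card_image_of_injOn hc, hcard]) x

lemma distR_add_distR_insert_le
    (hsymm : ∀ a b : E, a ≠ b → d a b = d b a)
    (hultra : ∀ a b c : E, a ≠ b → a ≠ c → b ≠ c → d a b ≤ max (d a c) (d b c))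
    {C : Finset E} {a b : E} (ha : a ∉ C) (hb : b ∉ C) (hab : a ≠ b) :
    distR d r C a + distR d r (insert a C) b ≤ distR d r C b + distR d r (insert b C) a := by
  have hcard_a : (insert a C).card = C.card + 1 := Finset.card_insert_of_notMem ha
  have hcard_b : (insert b C).card = C.card + 1 := Finset.card_insert_of_notMem hb
  rcases lt_or_ge C.card r with hr | hr
  · rw [distR_eq_zero hr.le, distR_eq_zero hr.le, distR_eq_zero (by omega),
      distR_eq_zero (by omega)]
  obtain ⟨A, hA, hAcard, hAsum⟩ := exists_distR_eq_sum d r C a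
  obtain ⟨B, hB, hBcard, hBsum⟩ := exists_distR_eq_sum d r (insert a C) b
  have exchange : ∀ x ∈ B, ∀ y ∈ insert b C, y ∉ A → B.erase x ⊆ C → d b x ≤ d a y →
      ∑ z ∈ A, d a z + ∑ z ∈ B, d b z ≤ distR d r C b + distR d r (insert b C) a := by
    intro x hx y hy hyA hBx hxy
    have h₁ := sum_le_distR (d := d) (r := r) hBx
      (by rw [Finset.card_erase_of_mem hx]; omega) b
    have h₂ := sum_le_distR (d := d) (r := r) (C := insert b C) (A := insert y A)
      (Finset.insert_subset hy (hA.trans (Finset.subset_insert _ _)))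
      (by rw [Finset.card_insert_of_notMem hyA]; omega) a
    rw [Finset.sum_insert hyA] at h₂
    have h₃ := Finset.add_sum_erase B (d b) hx
    linarith
  have hbA : b ∉ A := fun h => hb (hA h)
  rw [hAsum, hBsum]
  by_cases haB : a ∈ B
  · refine exchange a haB b (Finset.mem_insert_self _ _) hbA ?_ (hsymm b a hab.symm).le
    exact (Finset.subset_insert_iff).1 hB
  · have hBC : B ⊆ C := (Finset.subset_insert_iff_of_notMem haB).1 hB
    obtain ⟨x, hxB, hxA⟩ := Finset.exists_mem_notMem_of_card_lt_card
      (show A.card < B.card by omega)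
    have hxC := hBC hxB
    have hxa : x ≠ a := fun h => ha (h ▸ hxC)
    have hxb : x ≠ b := fun h => hb (h ▸ hxC)
    have hBx : B.erase x ⊆ C := (Finset.erase_subset _ _).trans hBC
    have hmax := hultra b x a hxb.symm hab.symm hxa
    rw [hsymm x a hxa, hsymm b a hab.symm] at hmax
    rcases le_max_iff.1 hmax with h | h
    · exact exchange x hxB b (Finset.mem_insert_self _ _) hbA hBx h
    · exact exchange x hxB x (Finset.mem_insert_of_mem hxC) hxA hBx h

lemma perList_eq_of_perm (w : E → ℝ)
    (hsymm : ∀ a b : E, a ≠ b → d a b = d b a)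
    (hultra : ∀ a b c : E, a ≠ b → a ≠ c → b ≠ c → d a b ≤ max (d a c) (d b c))
    {l₁ l₂ : List E} (h : l₁.Perm l₂) (hl : l₁.Nodup) :
    perList w d r l₁ = perList w d r l₂ := by
  induction h with
  | nil => rfl
  | cons a h ih =>
    simp only [perList]
    rw [ih (List.nodup_cons.1 hl).2, List.toFinset_eq_of_perm _ _ h]
  | swap a b l =>
    simp only [List.nodup_cons, List.mem_cons, not_or] at hl
    obtain ⟨⟨hba, hb⟩, ha, -⟩ := hl
    have ha' : a ∉ l.toFinset := by simpa using ha
    have hb' : b ∉ l.toFinset := by simpa using hb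
    have h₁ := distR_add_distR_insert_le (r := r) hsymm hultra ha' hb' (Ne.symm hba)
    have h₂ := distR_add_distR_insert_le (r := r) hsymm hultra hb' ha' hba
    simp only [perList, List.toFinset_cons]
    linarith
  | trans h₁ _ ih₁ ih₂ => exact (ih₁ hl).trans (ih₂ (h₁.nodup_iff.1 hl))

lemma perR_insert (w : E → ℝ)
    (hsymm : ∀ a b : E, a ≠ b → d a b = d b a)
    (hultra : ∀ a b c : E, a ≠ b → a ≠ c → b ≠ c → d a b ≤ max (d a c) (d b c))
    {S : Finset E} {a : E} (ha : a ∉ S) :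
    perR w d r (insert a S) = perR w d r S + w a + distR d r S a := by
  unfold perR
  rw [perList_eq_of_perm w hsymm hultra (Finset.toList_insert ha) (Finset.nodup_toList _),
    perList, Finset.toList_toFinset]

end DistR

section SeqProj

variable {E : Type*} [DecidableEq E] {d : E → E → ℝ} {A : Finset E} {k : ℕ} {c v : ℕ → E}

lemma exists_isProj (d : E → E → ℝ) {A : Finset E} (hA : A.Nonempty) (c : E) :
    ∃ b, IsProj d A c b := by
  by_cases hc : c ∈ A
  · exact ⟨c, Or.inl ⟨hc, rfl⟩⟩
  · obtain ⟨b, hb, hmin⟩ := A.exists_min_image (d c) hA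
    exact ⟨b, Or.inr ⟨hc, hb, hmin⟩⟩

lemma IsProj.mem {a b : E} (h : IsProj d A a b) : b ∈ A := by
  rcases h with ⟨h, rfl⟩ | ⟨-, h, -⟩ <;> exact h

lemma exists_isSeqProj (d : E → E → ℝ) (A : Finset E) (c : ℕ → E) {k : ℕ} (hk : k ≤ A.card) :
    ∃ v, IsSeqProj d A k c v := by
  induction k with
  | zero => exact ⟨c, fun i hi => absurd hi (Nat.not_lt_zero i)⟩
  | succ k ih =>
    obtain ⟨v, hv⟩ := ih (by omega)
    have hne : (A \ (Finset.range k).image v).Nonempty := by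
      rw [← Finset.card_pos]
      have h₁ := Finset.le_card_sdiff ((Finset.range k).image v) A
      have h₂ : ((Finset.range k).image v).card ≤ k := by
        simpa using Finset.card_image_le (s := Finset.range k) (f := v)
      omega
    obtain ⟨b, hb⟩ := exists_isProj d hne (c k)
    have himage : ∀ i ≤ k, (Finset.range i).image (Function.update v k b)
        = (Finset.range i).image v := by
      intro i hi
      refine Finset.image_congr fun j hj => Function.update_of_ne ?_ _ _
      have : j < i := by simpa using hj
      omega
    refine ⟨Function.update v k b, fun i hi => ?_⟩
    rw [himage i (by omega)]
    rcases Nat.lt_succ_iff_lt_or_eq.1 hi with hik | rfl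
    · rw [Function.update_of_ne hik.ne]
      exact hv i hik
    · rwa [Function.update_self]

lemma IsSeqProj.mem (hv : IsSeqProj d A k c v) {i : ℕ} (hi : i < k) : v i ∈ A :=
  (Finset.mem_sdiff.1 (hv i hi).mem).1

lemma IsSeqProj.ne (hv : IsSeqProj d A k c v) {i j : ℕ} (hi : i < k) (hj : j < i) :
    v j ≠ v i := fun h =>
  (Finset.mem_sdiff.1 (hv i hi).mem).2 (Finset.mem_image.2 ⟨j, Finset.mem_range.2 hj, h⟩)

lemma IsSeqProj.injOn (hv : IsSeqProj d A k c v) : Set.InjOn v (Finset.range k) := by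
  intro i hi j hj hij
  simp only [Finset.coe_range, Set.mem_Iio] at hi hj
  rcases lt_trichotomy i j with h | h | h
  · exact absurd hij (hv.ne hj h)
  · exact h
  · exact absurd hij.symm (hv.ne hi h)

lemma IsSeqProj.mem_sdiff (hv : IsSeqProj d A k c v) {i j : ℕ} (hi : i < k) (hj : j ≤ i) :
    v i ∈ A \ (Finset.range j).image v := by
  refine Finset.mem_sdiff.2 ⟨hv.mem hi, fun h => ?_⟩
  obtain ⟨l, hl, hli⟩ := Finset.mem_image.1 h
  exact hv.ne hi ((Finset.mem_range.1 hl).trans_le hj) hli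

lemma IsSeqProj.apply_ne (hv : IsSeqProj d A k c v) {i j : ℕ} (hi : i < k) (hj : j < i) :
    c j ≠ v i := by
  intro h
  rcases hv j (hj.trans hi) with ⟨-, h'⟩ | ⟨h', -, -⟩
  · exact hv.ne hi hj (h'.trans h)
  · exact h' (h ▸ hv.mem_sdiff hi hj.le)

lemma IsSeqProj.dist_le
    (hsymm : ∀ a b : E, a ≠ b → d a b = d b a)
    (hultra : ∀ a b c : E, a ≠ b → a ≠ c → b ≠ c → d a b ≤ max (d a c) (d b c))
    (hv : IsSeqProj d A k c v) {i j : ℕ} (hi : i < k) (hj : j < i) :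
    d (v i) (v j) ≤ d (v i) (c j) := by
  rcases hv j (hj.trans hi) with ⟨-, h⟩ | ⟨hc, hmem, hmin⟩
  · rw [h]
  · have hcv : c j ≠ v j := fun h => hc (h ▸ hmem)
    have hci := hv.apply_ne hi hj
    refine (hultra (v i) (v j) (c j) (hv.ne hi hj).symm hci.symm hcv.symm).trans
      (max_le le_rfl ?_)
    rw [hsymm _ _ hcv.symm, hsymm _ _ hci.symm]
    exact hmin _ (hv.mem_sdiff hi hj.le)

end SeqProj

theorem stmt5 {E : Type*} [DecidableEq E] (w : E → ℝ) (d : E → E → ℝ)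
    (hsymm : ∀ a b : E, a ≠ b → d a b = d b a)
    (hultra : ∀ a b c : E, a ≠ b → a ≠ c → b ≠ c → d a b ≤ max (d a c) (d b c))
    (r m : ℕ) (C : Finset E) (c : ℕ → E) (hc : IsGreedy w d r C m c) :
    ∀ k ≤ m, ∀ B ⊆ C, B.card = k →
      perR w d r B ≤ perR w d r ((Finset.range k).image c) := by
  intro k hk B hB hBk
  obtain ⟨-, hinj, hgreedy⟩ := hc
  obtain ⟨v, hv⟩ := exists_isSeqProj d B c hBk.ge
  have hle : ∀ i ≤ k,
      perR w d r ((Finset.range i).image v) ≤ perR w d r ((Finset.range i).image c) := by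
    intro i
    induction i with
    | zero => intro _; simp
    | succ i ih =>
      intro hi
      have hvi : v i ∉ (Finset.range i).image v := (Finset.mem_sdiff.1 (hv i hi).mem).2
      have hci : v i ∉ (Finset.range i).image c := by
        intro h
        obtain ⟨j, hj, hji⟩ := Finset.mem_image.1 h
        exact hv.apply_ne hi (Finset.mem_range.1 hj) hji
      have hg := hgreedy i (by omega) (v i) (hB (hv.mem hi)) hci
      have hdist : distR d r ((Finset.range i).image v) (v i)
          ≤ distR d r ((Finset.range i).image c) (v i) := by
        refine distR_image_le_distR_image (hv.injOn.mono ?_) ?_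
          fun j hj => hv.dist_le hsymm hultra hi hj
        · simpa using (Nat.le_of_succ_le hi)
        · intro j hj l hl hjl
          simp only [Finset.coe_range, Set.mem_Iio] at hj hl
          exact hinj j (by omega) l (by omega) hjl
      rw [perR_insert w hsymm hultra hci] at hg
      rw [Finset.range_add_one, Finset.image_insert, Finset.image_insert,
        perR_insert w hsymm hultra hvi]
      linarith [ih (by omega)]
  have himage : (Finset.range k).image v = B := by
    refine Finset.eq_of_subset_of_card_le ?_ ?_
    · exact Finset.image_subset_iff.2 fun i hi => hv.mem (Finset.mem_range.1 hi)
    · rw [Finset.card_image_of_injOn hv.injOn, Finset.card_range, hBk]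
  simpa only [himage] using hle k le_rfl
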